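/- If a variable-set automaton A with state set Q and variable set V is satisfiable (there exist a document d and a mapping μ ∈ ⟦A⟧_d), then there exists a document of length at most (2|V|+1)·|Q| that satisfies A. -/

import Mathlib

/-- A mapping: a partial function from variables to spans (pairs of naturals). -/
abbrev Mapping (V : Type) : Type := V → Option (ℕ × ℕ)

/-- Transition labels of a variable-set automaton: a letter, ε, or opening/closing a
variable. -/
inductive VLabel (σ V : Type) : Type
  | ltr (a : σ) : VLabel σ V
  | eps : VLabel σ V
  | vopen (x : V) : VLabel σ V
  | vclose (x : V) : VLabel σ V
deriving DecidableEq

/-- A variable-set automaton `(Q, q0, qf, δ)`. -/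
structure VA (σ V Q : Type) where
  init : Q
  final : Q
  delta : Set (Q × VLabel σ V × Q)

/-- A transition. -/
abbrev Tr (σ V Q : Type) : Type := Q × VLabel σ V × Q

/-- A list of transitions forms a chain starting at state `q`. -/
def ChainFrom {σ V Q : Type} (q : Q) (trs : List (Tr σ V Q)) : Prop :=
  (∀ t ∈ trs.head?, t.1 = q) ∧
  ∀ (i : ℕ) (h : i + 1 < trs.length),
    (trs[i]'(Nat.lt_of_succ_lt h)).2.2 = (trs[i + 1]'h).1

/-- The end state of a chain of transitions starting at `q`. -/
def endState {σ V Q : Type} (q : Q) (trs : List (Tr σ V Q)) : Q :=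
  match trs.getLast? with
  | none => q
  | some t => t.2.2

/-- The word spelled by the letter transitions of a run. -/
def word {σ V Q : Type} (trs : List (Tr σ V Q)) : List σ :=
  trs.filterMap (fun t => match t.2.1 with | VLabel.ltr a => some a | _ => none)

/-- The number of `⊢x` transitions in a list of transitions. -/
def openCount {σ V Q : Type} [DecidableEq σ] [DecidableEq V] (x : V)
    (trs : List (Tr σ V Q)) : ℕ :=
  trs.countP (fun t => t.2.1 = VLabel.vopen x)

/-- The number of `⊣x` transitions in a list of transitions. -/
def closeCount {σ V Q : Type} [DecidableEq σ] [DecidableEq V] (x : V)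
    (trs : List (Tr σ V Q)) : ℕ :=
  trs.countP (fun t => t.2.1 = VLabel.vclose x)

/-- Variables are used correctly in a run: each variable is opened at most once, closed at
most once, and closed only after being opened. -/
def ValidVars {σ V Q : Type} [DecidableEq σ] [DecidableEq V]
    (trs : List (Tr σ V Q)) : Prop :=
  ∀ x : V, openCount x trs ≤ 1 ∧ closeCount x trs ≤ 1 ∧
    ∀ p : List (Tr σ V Q), p <+: trs → closeCount x p ≤ openCount x p

/-- `trs` is an accepting run of `A` over the document `d`. -/
def AccRun {σ V Q : Type} [DecidableEq σ] [DecidableEq V] (A : VA σ V Q) (d : List σ)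
    (trs : List (Tr σ V Q)) : Prop :=
  (∀ t ∈ trs, t ∈ A.delta) ∧ ChainFrom A.init trs ∧ endState A.init trs = A.final ∧
  word trs = d ∧ ValidVars trs

/-- The document position just before the `i`-th transition of a run:
one plus the number of preceding letter transitions. -/
def posAt {σ V Q : Type} (trs : List (Tr σ V Q)) (i : ℕ) : ℕ :=
  1 + (word (trs.take i)).length

/-- The mapping induced by a run: `x` is sent to the span between its opening and its
closing transition, and is undefined if `x` is not both opened and closed. -/
def runMapping {σ V Q : Type} [DecidableEq σ] [DecidableEq V]
    (trs : List (Tr σ V Q)) : Mapping V :=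
  fun x =>
    match trs.findIdx? (fun t => t.2.1 = VLabel.vopen x),
          trs.findIdx? (fun t => t.2.1 = VLabel.vclose x) with
    | some i, some j => some (posAt trs i, posAt trs j)
    | _, _ => none

/-- The semantics `⟦A⟧_d` of a VA `A` over a document `d`: the set of mappings of
accepting runs of `A` over `d`. -/
def semVA {σ V Q : Type} [DecidableEq σ] [DecidableEq V] (A : VA σ V Q) (d : List σ) :
    Set (Mapping V) :=
  {μ | ∃ trs, AccRun A d trs ∧ μ = runMapping trs}

theorem chainFrom_cons {σ V Q : Type} {q : Q} {t : Tr σ V Q} {l : List (Tr σ V Q)} :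
    ChainFrom q (t :: l) ↔ t.1 = q ∧ ChainFrom t.2.2 l := by
  constructor
  · rintro ⟨h, hs⟩
    refine ⟨h t (by simp), ?_, fun i hi => hs (i + 1) (by simpa using hi)⟩
    cases l with
    | nil => simp
    | cons u l => simpa using (hs 0 (by simp)).symm
  · rintro ⟨h, h0, hs⟩
    refine ⟨by simpa using h, fun i hi => ?_⟩
    cases i with
    | zero =>
      cases l with
      | nil => simp at hi
      | cons u l => simpa using (h0 u (by simp)).symm
    | succ i => exact hs i (by simpa using hi)

theorem endState_cons {σ V Q : Type} (q : Q) (t : Tr σ V Q) (l : List (Tr σ V Q)) :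
    endState q (t :: l) = endState t.2.2 l := by
  cases l with
  | nil => rfl
  | cons u l => simp [endState, List.getLast?_cons]

theorem endState_append {σ V Q : Type} (q : Q) (a b : List (Tr σ V Q)) :
    endState q (a ++ b) = endState (endState q a) b := by
  induction a generalizing q with
  | nil => rfl
  | cons t a ih => simp only [List.cons_append, endState_cons, ih]

theorem chainFrom_append {σ V Q : Type} {q : Q} {a b : List (Tr σ V Q)} :
    ChainFrom q (a ++ b) ↔ ChainFrom q a ∧ ChainFrom (endState q a) b := by
  induction a generalizing q with
  | nil => simp [endState, ChainFrom]
  | cons t a ih => simp only [List.cons_append, chainFrom_cons, endState_cons, ih, and_assoc]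

/-- Whether a transition reads a letter. -/
def Tr.isLetter {σ V Q : Type} (t : Tr σ V Q) : Bool :=
  match t.2.1 with
  | VLabel.ltr _ => true
  | _ => false

/-- Whether a transition opens or closes a variable. -/
def Tr.isVar {σ V Q : Type} (t : Tr σ V Q) : Bool :=
  match t.2.1 with
  | VLabel.vopen _ => true
  | VLabel.vclose _ => true
  | _ => false

theorem word_append {σ V Q : Type} (a b : List (Tr σ V Q)) :
    word (a ++ b) = word a ++ word b :=
  List.filterMap_append

theorem length_word {σ V Q : Type} (l : List (Tr σ V Q)) :
    (word l).length = (l.filter Tr.isLetter).length := by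
  induction l with
  | nil => rfl
  | cons t l ih =>
    obtain ⟨p, lab, r⟩ := t
    unfold word at ih
    cases lab <;> simp [word, Tr.isLetter, List.filter_cons, ih]

theorem countP_isVar {σ V Q : Type} [DecidableEq σ] [DecidableEq V] [Fintype V]
    (l : List (Tr σ V Q)) :
    l.countP Tr.isVar = ∑ x : V, (openCount x l + closeCount x l) := by
  induction l with
  | nil => simp [openCount, closeCount]
  | cons t l ih =>
    obtain ⟨p, lab, r⟩ := t
    unfold openCount closeCount at ih
    rw [Finset.sum_add_distrib] at ih ⊢
    cases lab <;>
      simp [openCount, closeCount, Tr.isVar, List.countP_cons, ih, Finset.sum_add_distrib] <;>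
      omega

theorem ValidVars.countP_isVar_le {σ V Q : Type} [DecidableEq σ] [DecidableEq V] [Fintype V]
    {l : List (Tr σ V Q)} (h : ValidVars l) : l.countP Tr.isVar ≤ 2 * Fintype.card V := by
  rw [countP_isVar, mul_comm]
  refine (Finset.sum_le_card_nsmul _ _ 2 fun x _ => ?_).trans_eq (by simp)
  obtain ⟨h1, h2, -⟩ := h x
  omega

/-- Deleting a factor without variable transitions preserves correct use of variables. -/
theorem ValidVars.of_append {σ V Q : Type} [DecidableEq σ] [DecidableEq V]
    {a b c : List (Tr σ V Q)} (h : ValidVars (a ++ (b ++ c))) (hb : b.countP Tr.isVar = 0) :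
    ValidVars (a ++ c) := by
  intro x
  have hb' : ∀ t ∈ b, t.isVar = false := by simpa [List.countP_eq_zero] using hb
  have ho : openCount x b = 0 := by
    refine List.countP_eq_zero.2 fun t ht h => ?_
    have := hb' t ht
    simp_all [Tr.isVar]
  have hc : closeCount x b = 0 := by
    refine List.countP_eq_zero.2 fun t ht h => ?_
    have := hb' t ht
    simp_all [Tr.isVar]
  obtain ⟨h1, h2, h3⟩ := h x
  unfold openCount closeCount at *
  simp only [List.countP_append] at h1 h2 ⊢
  refine ⟨by omega, by omega, fun p hp => ?_⟩
  obtain ⟨s, hs⟩ := hp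
  rcases List.append_eq_append_iff.1 hs with ⟨u, rfl, -⟩ | ⟨p', rfl, rfl⟩
  · exact h3 p ⟨u ++ (b ++ c), by simp⟩
  · have := h3 (a ++ (b ++ p')) ⟨s, by simp⟩
    simp only [List.countP_append] at this ⊢
    omega

/-- Deleting a cycle without variable transitions from an accepting run. -/
theorem AccRun.delete_cycle {σ V Q : Type} [DecidableEq σ] [DecidableEq V] {A : VA σ V Q}
    {d : List σ} {a b c : List (Tr σ V Q)} (h : AccRun A d (a ++ (b ++ c)))
    (hb : b.countP Tr.isVar = 0)
    (hq : endState A.init (a ++ b) = endState A.init a) :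
    AccRun A (word (a ++ c)) (a ++ c) := by
  obtain ⟨hδ, hch, hend, -, hv⟩ := h
  refine ⟨fun t ht => hδ t ?_, ?_, ?_, rfl, hv.of_append hb⟩
  · simp only [List.mem_append] at ht ⊢
    tauto
  · rw [← List.append_assoc, chainFrom_append, chainFrom_append, hq] at hch
    exact chainFrom_append.2 ⟨hch.1.1, hch.2⟩
  · rw [← List.append_assoc, endState_append, hq] at hend
    rw [endState_append, hend]

theorem ChainFrom.endState_take {σ V Q : Type} {q : Q} {l : List (Tr σ V Q)}
    (h : ChainFrom q l) (i : Fin l.length) : endState q (l.take i) = (l.get i).1 := by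
  rw [← List.take_append_drop i l, chainFrom_append, List.drop_eq_getElem_cons i.2,
    chainFrom_cons] at h
  exact h.2.1.symm

/-- An accepting run over a long document can be shortened. -/
theorem AccRun.exists_shorter {σ V Q : Type} [DecidableEq σ] [DecidableEq V]
    [Fintype V] [Fintype Q] {A : VA σ V Q} {d : List σ} {l : List (Tr σ V Q)}
    (h : AccRun A d l) (hd : (2 * Fintype.card V + 1) * Fintype.card Q < d.length) :
    ∃ (d' : List σ) (l' : List (Tr σ V Q)), AccRun A d' l' ∧ d'.length < d.length := by
  obtain ⟨f, hf⟩ := List.sublist_iff_exists_fin_orderEmbedding_get_eq.1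
    (List.filter_sublist (p := Tr.isLetter) (l := l))
  have hch := h.2.1
  have hw := h.2.2.2.1
  have hv := h.2.2.2.2.countP_isVar_le
  let g : Fin (l.filter Tr.isLetter).length → Fin (2 * Fintype.card V + 1) × Q := fun i =>
    (⟨(l.take (f i)).countP Tr.isVar,
      Nat.lt_succ_of_le (((List.take_sublist _ _).countP_le).trans hv)⟩, (l.get (f i)).1)
  have hcard : Fintype.card (Fin (2 * Fintype.card V + 1) × Q) <
      Fintype.card (Fin (l.filter Tr.isLetter).length) := by
    rw [Fintype.card_prod, Fintype.card_fin, Fintype.card_fin, ← length_word, hw]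
    exact hd
  obtain ⟨i, j, hij, hg⟩ : ∃ i j, i < j ∧ g i = g j := by
    obtain ⟨i, j, hne, hg⟩ := Fintype.exists_ne_map_eq_of_card_lt g hcard
    rcases hne.lt_or_gt with hlt | hlt
    · exact ⟨i, j, hlt, hg⟩
    · exact ⟨j, i, hlt, hg.symm⟩
  have hlt : (f i : ℕ) < f j := f.strictMono hij
  obtain ⟨hcount, hstate⟩ := Prod.mk.inj hg
  replace hcount := Fin.mk.inj hcount
  set a := l.take (f i) with ha
  set b := (l.drop (f i)).take (f j - f i) with hb
  set c := l.drop (f j) with hc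
  have hab : l.take (f j) = a ++ b := by
    rw [ha, hb, ← List.take_add, Nat.add_sub_cancel' hlt.le]
  have hl : l = a ++ (b ++ c) := by
    rw [← List.append_assoc, ← hab, hc, List.take_append_drop]
  have hbv : b.countP Tr.isVar = 0 := by
    rw [hab, List.countP_append] at hcount
    omega
  have hq : endState A.init (a ++ b) = endState A.init a := by
    rw [← hab, hch.endState_take, ha, hch.endState_take, hstate]
  have hpos : 0 < (word b).length := by
    rw [length_word]
    refine List.length_pos_of_mem (a := l.get (f i)) (List.mem_filter.2 ⟨?_, ?_⟩)
    · rw [hb, List.drop_eq_getElem_cons (f i).2]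
      obtain ⟨k, hk⟩ := Nat.exists_eq_add_of_lt hlt
      rw [show (f j : ℕ) - f i = k + 1 by omega, List.take_succ_cons]
      simp
    · rw [← hf i]
      exact (List.mem_filter.1 (List.get_mem _ i)).2
  refine ⟨_, _, (hl ▸ h).delete_cycle hbv hq, ?_⟩
  rw [← hw, congrArg word hl]
  simp only [word_append, List.length_append]
  omega

/-- If a VA `A` with state set `Q` and variable set `V` is satisfiable, then some document
of length at most `(2|V|+1)·|Q|` satisfies `A`. -/
theorem va_small_model {σ V Q : Type} [DecidableEq σ] [DecidableEq V]
    [Fintype V] [Fintype Q] (A : VA σ V Q)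
    (hsat : ∃ (d : List σ) (μ : Mapping V), μ ∈ semVA A d) :
    ∃ (d : List σ) (μ : Mapping V), μ ∈ semVA A d ∧
      d.length ≤ (2 * Fintype.card V + 1) * Fintype.card Q := by
  classical
  obtain ⟨d, -, l, hl, -⟩ := hsat
  have hex : ∃ n, ∃ (d : List σ) (l : List (Tr σ V Q)), AccRun A d l ∧ d.length = n :=
    ⟨_, d, l, hl, rfl⟩
  obtain ⟨d, l, hl, hd⟩ := Nat.find_spec hex
  refine ⟨d, _, ⟨l, hl, rfl⟩, le_of_not_gt fun hlt => ?_⟩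
  obtain ⟨d', l', hl', hlt'⟩ := hl.exists_shorter hlt
  exact Nat.find_min hex (hd ▸ hlt') ⟨d', l', hl', rfl⟩
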